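/- arXiv:2108.02361 — 9 statements merged into one kernel-verified Lean document; each statement's English description precedes it below -/
import Mathlib

section
/- (Feasibility region of Problem P1.) A pair (α1, α2) ∈ [0,1]² satisfies the five constraints R_d(α1) ≥ R_th, R_s(α1) ≥ R_th, R_d(α2) ≥ R_th, R_s(α2) ≥ R_th and R_w(α1,α2) ≥ R_th if and only if α_min ≤ α1 ≤ α_max, α_min ≤ α2 ≤ α_max, and g(α1,α2) ≥ 0. -/
/-- Feasibility region of problem P1. -/
theorem stmt_3 (B c γ Rth h1 h2 : ℝ) (hB : 0 < B) (hc : 0 < c) (hγ : 0 < γ)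
    (hR : 0 ≤ Rth) (hh1 : 0 < h1) (hh2 : 0 < h2)
    (Rs : ℝ → ℝ) (hRs : ∀ α, Rs α = B / 2 * Real.log (1 + c * γ * (1 - α)))
    (Rd : ℝ → ℝ) (hRd : ∀ α, Rd α = B / 2 * Real.log (1 + c * α / (c * (1 - α) + 1 / γ)))
    (t : ℝ) (ht : t = Real.exp (2 * Rth / B) - 1)
    (αmin : ℝ) (hαmin : αmin = t * (c * γ + 1) / (c * γ * (1 + t)))
    (αmax : ℝ) (hαmax : αmax = 1 - t / (c * γ))
    (Rw : ℝ → ℝ → ℝ)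
    (hRw : ∀ α1 α2, Rw α1 α2 = B / 2 * Real.log (1 +
      c * (h1 * Real.sqrt α1 + h2 * Real.sqrt α2) ^ 2 /
        (c * h1 ^ 2 * (1 - α1) + c * h2 ^ 2 * (1 - α2) + 1 / γ)))
    (g : ℝ → ℝ → ℝ)
    (hg : ∀ α1 α2, g α1 α2 = c * (1 + t) * h1 ^ 2 * α1 + c * (1 + t) * h2 ^ 2 * α2 +
      2 * c * h1 * h2 * Real.sqrt (α1 * α2) - t * (c * h1 ^ 2 + c * h2 ^ 2 + 1 / γ)) :
    ∀ α1 ∈ Set.Icc (0 : ℝ) 1, ∀ α2 ∈ Set.Icc (0 : ℝ) 1,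
      (Rd α1 ≥ Rth ∧ Rs α1 ≥ Rth ∧ Rd α2 ≥ Rth ∧ Rs α2 ≥ Rth ∧ Rw α1 α2 ≥ Rth) ↔
        (αmin ≤ α1 ∧ α1 ≤ αmax ∧ αmin ≤ α2 ∧ α2 ≤ αmax ∧ g α1 α2 ≥ 0) := by
  intro α1 ⟨ha0, ha1⟩ α2 ⟨hb0, hb1⟩
  have ht0 : 0 ≤ t := by
    have : 1 ≤ Real.exp (2 * Rth / B) := Real.one_le_exp (by positivity)
    linarith
  have hcγ : 0 < c * γ := mul_pos hc hγ
  have key : ∀ y : ℝ, 0 ≤ y → (B / 2 * Real.log (1 + y) ≥ Rth ↔ t ≤ y) := by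
    intro y hy
    have h1 : B / 2 * Real.log (1 + y) ≥ Rth ↔ 2 * Rth / B ≤ Real.log (1 + y) := by
      rw [div_le_iff₀ hB]
      constructor <;> intro h <;> nlinarith
    rw [h1, Real.le_log_iff_exp_le (by linarith), ht]
    constructor <;> intro h <;> linarith
  have hs : ∀ α, 0 ≤ α → α ≤ 1 → (Rs α ≥ Rth ↔ α ≤ αmax) := by
    intro α h0 h1
    rw [hRs, key _ (mul_nonneg hcγ.le (by linarith)), hαmax, le_sub_comm, div_le_iff₀ hcγ, mul_comm]
  have hig : 0 < 1 / γ := by positivity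
  have hd : ∀ α, 0 ≤ α → α ≤ 1 → (Rd α ≥ Rth ↔ αmin ≤ α) := by
    intro α h0 h1
    have hD : 0 < c * (1 - α) + 1 / γ :=
      add_pos_of_nonneg_of_pos (mul_nonneg hc.le (by linarith)) hig
    rw [hRd, key _ (div_nonneg (by positivity) hD.le), hαmin, le_div_iff₀ hD,
      div_le_iff₀ (by positivity)]
    rw [← mul_le_mul_iff_left₀ hγ]
    have e : t * (c * (1 - α) + 1 / γ) * γ = t * (c * γ * (1 - α) + 1) := by
      field_simp
    rw [e]
    constructor <;> intro h <;> linarith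
  have hw : Rw α1 α2 ≥ Rth ↔ g α1 α2 ≥ 0 := by
    have hD : 0 < c * h1 ^ 2 * (1 - α1) + c * h2 ^ 2 * (1 - α2) + 1 / γ :=
      add_pos_of_nonneg_of_pos (add_nonneg (mul_nonneg (by positivity) (by linarith))
        (mul_nonneg (by positivity) (by linarith))) hig
    rw [hRw, key _ (div_nonneg (by positivity) hD.le), hg, le_div_iff₀ hD, Real.sqrt_mul ha0]
    have e : c * (h1 * Real.sqrt α1 + h2 * Real.sqrt α2) ^ 2 = c * h1 ^ 2 * α1 + c * h2 ^ 2 * α2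
        + 2 * c * h1 * h2 * (Real.sqrt α1 * Real.sqrt α2) := by
      have e1 := Real.sq_sqrt ha0
      have e2 := Real.sq_sqrt hb0
      linear_combination c * h1 ^ 2 * e1 + c * h2 ^ 2 * e2
    rw [e]
    constructor <;> intro h <;> linarith
  rw [hs α1 ha0 ha1, hs α2 hb0 hb1, hd α1 ha0 ha1, hd α2 hb0 hb1, hw]
end

section
/- (Theorem 1.) There exists a pair (α1, α2) ∈ [0,1]² satisfying R_d(α1) ≥ R_th, R_s(α1) ≥ R_th, R_d(α2) ≥ R_th, R_s(α2) ≥ R_th and R_w(α1,α2) ≥ R_th if and only if the following two conditions hold: (Condition 1) α_min ≤ α_max, and (Condition 2) g(α_max, α_max) ≥ 0. -/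
/-- Theorem 1: feasibility conditions of problem P1. -/
theorem stmt_4 (B c γ Rth h1 h2 : ℝ) (hB : 0 < B) (hc : 0 < c) (hγ : 0 < γ)
    (hR : 0 ≤ Rth) (hh1 : 0 < h1) (hh2 : 0 < h2)
    (Rs : ℝ → ℝ) (hRs : ∀ α, Rs α = B / 2 * Real.log (1 + c * γ * (1 - α)))
    (Rd : ℝ → ℝ) (hRd : ∀ α, Rd α = B / 2 * Real.log (1 + c * α / (c * (1 - α) + 1 / γ)))
    (t : ℝ) (ht : t = Real.exp (2 * Rth / B) - 1)
    (αmin : ℝ) (hαmin : αmin = t * (c * γ + 1) / (c * γ * (1 + t)))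
    (αmax : ℝ) (hαmax : αmax = 1 - t / (c * γ))
    (Rw : ℝ → ℝ → ℝ)
    (hRw : ∀ α1 α2, Rw α1 α2 = B / 2 * Real.log (1 +
      c * (h1 * Real.sqrt α1 + h2 * Real.sqrt α2) ^ 2 /
        (c * h1 ^ 2 * (1 - α1) + c * h2 ^ 2 * (1 - α2) + 1 / γ)))
    (g : ℝ → ℝ → ℝ)
    (hg : ∀ α1 α2, g α1 α2 = c * (1 + t) * h1 ^ 2 * α1 + c * (1 + t) * h2 ^ 2 * α2 +
      2 * c * h1 * h2 * Real.sqrt (α1 * α2) - t * (c * h1 ^ 2 + c * h2 ^ 2 + 1 / γ)) :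
    (∃ α1 ∈ Set.Icc (0 : ℝ) 1, ∃ α2 ∈ Set.Icc (0 : ℝ) 1,
      Rd α1 ≥ Rth ∧ Rs α1 ≥ Rth ∧ Rd α2 ≥ Rth ∧ Rs α2 ≥ Rth ∧ Rw α1 α2 ≥ Rth) ↔
        (αmin ≤ αmax ∧ g αmax αmax ≥ 0) := by
  have ht0 : 0 ≤ t := by
    have : 1 ≤ Real.exp (2 * Rth / B) := Real.one_le_exp (by positivity)
    linarith
  have hcg : 0 < c * γ := mul_pos hc hγ
  have hig : 0 < 1 / γ := by positivity
  have key : ∀ x : ℝ, 0 ≤ x → (B / 2 * Real.log (1 + x) ≥ Rth ↔ t ≤ x) := by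
    intro x hx
    have e1 : B / 2 * Real.log (1 + x) ≥ Rth ↔ 2 * Rth / B ≤ Real.log (1 + x) := by
      rw [div_le_iff₀ hB]
      constructor <;> intro h <;> linarith
    rw [e1, Real.le_log_iff_exp_le (by linarith), ht]
    constructor <;> intro h <;> linarith
  have kS : ∀ α ∈ Set.Icc (0 : ℝ) 1, (Rs α ≥ Rth ↔ α ≤ αmax) := by
    intro α hα
    rw [hRs, key _ (mul_nonneg hcg.le (by linarith [hα.2])), hαmax, le_sub_comm,
      div_le_iff₀ hcg, mul_comm (c * γ)]
  have kD : ∀ α ∈ Set.Icc (0 : ℝ) 1, (Rd α ≥ Rth ↔ αmin ≤ α) := by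
    intro α hα
    have hd : 0 < c * (1 - α) + 1 / γ := by
      have := mul_nonneg hc.le (sub_nonneg.2 hα.2)
      linarith
    rw [hRd, key _ (div_nonneg (mul_nonneg hc.le hα.1) hd.le), hαmin, le_div_iff₀ hd,
      div_le_iff₀ (by positivity), ← mul_le_mul_iff_left₀ hγ]
    have e : t * (c * (1 - α) + 1 / γ) * γ = t * (c * γ * (1 - α) + 1) := by
      field_simp
    rw [e]
    constructor <;> intro h <;> linarith
  have kW : ∀ α ∈ Set.Icc (0 : ℝ) 1, ∀ β ∈ Set.Icc (0 : ℝ) 1,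
      (Rw α β ≥ Rth ↔ g α β ≥ 0) := by
    intro α hα β hβ
    have hd : 0 < c * h1 ^ 2 * (1 - α) + c * h2 ^ 2 * (1 - β) + 1 / γ := by
      have := mul_nonneg (by positivity : 0 ≤ c * h1 ^ 2) (sub_nonneg.2 hα.2)
      have := mul_nonneg (by positivity : 0 ≤ c * h2 ^ 2) (sub_nonneg.2 hβ.2)
      linarith
    rw [hRw, key _ (div_nonneg (by positivity) hd.le), le_div_iff₀ hd, hg,
      Real.sqrt_mul hα.1]
    have e : c * (h1 * √α + h2 * √β) ^ 2 =
        c * h1 ^ 2 * α + c * h2 ^ 2 * β + 2 * c * h1 * h2 * (√α * √β) := by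
      have a := Real.sq_sqrt hα.1
      have b := Real.sq_sqrt hβ.1
      linear_combination c * h1 ^ 2 * a + c * h2 ^ 2 * b
    rw [e]
    constructor <;> intro h <;> linarith
  constructor
  · rintro ⟨α, hα, β, hβ, d1, s1, d2, s2, w⟩
    rw [kD α hα] at d1
    rw [kS α hα] at s1
    rw [kS β hβ] at s2
    rw [kW α hα β hβ, hg] at w
    refine ⟨d1.trans s1, ?_⟩
    rw [hg]
    have hm : √(α * β) ≤ √(αmax * αmax) :=
      Real.sqrt_le_sqrt (mul_le_mul s1 s2 hβ.1 (hα.1.trans s1))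
    have i1 := mul_le_mul_of_nonneg_left s1 (by positivity : 0 ≤ c * (1 + t) * h1 ^ 2)
    have i2 := mul_le_mul_of_nonneg_left s2 (by positivity : 0 ≤ c * (1 + t) * h2 ^ 2)
    have i3 := mul_le_mul_of_nonneg_left hm (by positivity : 0 ≤ 2 * c * h1 * h2)
    linarith
  · rintro ⟨h, hgg⟩
    have h0 : 0 ≤ αmin := by rw [hαmin]; positivity
    have h1' : αmax ≤ 1 := by
      have : 0 ≤ t / (c * γ) := by positivity
      linarith
    have hm : αmax ∈ Set.Icc (0 : ℝ) 1 := ⟨h0.trans h, h1'⟩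
    exact ⟨αmax, hm, αmax, hm, (kD _ hm).2 h, (kS _ hm).2 le_rfl, (kD _ hm).2 h,
      (kS _ hm).2 le_rfl, (kW _ hm _ hm).2 hgg⟩
end

section
/- (Theorem 2.) There exists a pair (α1, α2) ∈ [0,1]² satisfying R_d(α1) ≥ R_th, R_s(α1) ≥ R_th, R_d(α2) ≥ R_th, R_s(α2) ≥ R_th and (B_r/2)·log(1 + S) ≥ R_th if and only if the following two conditions hold: (Condition 1) α_min ≤ α_max, and (Condition 2) t_r ≤ S, where t_r = exp(2·R_th/B_r) − 1. -/
theorem rate_aux (B R x : ℝ) (hB : 0 < B) (hx : 0 ≤ x) :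
    B / 2 * Real.log (1 + x) ≥ R ↔ Real.exp (2 * R / B) - 1 ≤ x := by
  have h1 : B / 2 * Real.log (1 + x) ≥ R ↔ 2 * R / B ≤ Real.log (1 + x) := by
    rw [div_le_iff₀ hB]
    constructor <;> intro h <;> linarith
  rw [h1, Real.le_log_iff_exp_le (by linarith)]
  constructor <;> intro h <;> linarith

/-- Theorem 2: feasibility conditions of problem P2. -/
theorem stmt_5 (B c γ Rth Br S : ℝ) (hB : 0 < B) (hc : 0 < c) (hγ : 0 < γ)
    (hR : 0 ≤ Rth) (hBr : 0 < Br) (hS : 0 ≤ S)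
    (Rs : ℝ → ℝ) (hRs : ∀ α, Rs α = B / 2 * Real.log (1 + c * γ * (1 - α)))
    (Rd : ℝ → ℝ) (hRd : ∀ α, Rd α = B / 2 * Real.log (1 + c * α / (c * (1 - α) + 1 / γ)))
    (t : ℝ) (ht : t = Real.exp (2 * Rth / B) - 1)
    (αmin : ℝ) (hαmin : αmin = t * (c * γ + 1) / (c * γ * (1 + t)))
    (αmax : ℝ) (hαmax : αmax = 1 - t / (c * γ))
    (tr : ℝ) (htr : tr = Real.exp (2 * Rth / Br) - 1) :
    (∃ α1 ∈ Set.Icc (0 : ℝ) 1, ∃ α2 ∈ Set.Icc (0 : ℝ) 1,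
      Rd α1 ≥ Rth ∧ Rs α1 ≥ Rth ∧ Rd α2 ≥ Rth ∧ Rs α2 ≥ Rth ∧
        Br / 2 * Real.log (1 + S) ≥ Rth) ↔
      (αmin ≤ αmax ∧ tr ≤ S) := by
  have ht0 : 0 ≤ t := by
    have : 1 ≤ Real.exp (2 * Rth / B) := Real.one_le_exp (by positivity)
    linarith
  have hcg : 0 < c * γ := mul_pos hc hγ
  have hs : ∀ α ∈ Set.Icc (0 : ℝ) 1, (Rs α ≥ Rth ↔ α ≤ αmax) := by
    intro α hα
    have h1 : 0 ≤ 1 - α := by linarith [hα.2]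
    rw [hRs, rate_aux _ _ _ hB (by positivity), ← ht, hαmax, le_sub_comm, div_le_iff₀ hcg, mul_comm]
  have hd : ∀ α ∈ Set.Icc (0 : ℝ) 1, (Rd α ≥ Rth ↔ αmin ≤ α) := by
    intro α hα
    have h0 := hα.1
    have h1 : 0 ≤ 1 - α := by linarith [hα.2]
    have hD : 0 < c * (1 - α) + 1 / γ := by positivity
    rw [hRd, rate_aux _ _ _ hB (by positivity), ← ht, hαmin, le_div_iff₀ hD,
      div_le_iff₀ (by positivity), ← mul_le_mul_iff_left₀ hγ]
    have e : t * (c * (1 - α) + 1 / γ) * γ = t * (c * γ * (1 - α) + 1) := by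
      field_simp
    rw [e]
    constructor <;> intro h <;> nlinarith
  rw [rate_aux _ _ _ hBr hS, ← htr]
  constructor
  · rintro ⟨a, ha, _, _, h1, h2, _, _, h5⟩
    exact ⟨((hd a ha).1 h1).trans ((hs a ha).1 h2), h5⟩
  · rintro ⟨h, h5⟩
    have hm : αmin ∈ Set.Icc (0 : ℝ) 1 := by
      constructor
      · rw [hαmin]; positivity
      · have : 0 ≤ t / (c * γ) := by positivity
        linarith
    have a := (hd _ hm).2 le_rfl
    have b := (hs _ hm).2 h
    exact ⟨αmin, hm, αmin, hm, a, b, a, b, h5⟩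
end

section
/- For each fixed α2 ∈ [0,1], the function α1 ↦ R_w(α1, α2) is strictly increasing on [0,1], and for each fixed α1 ∈ [0,1], the function α2 ↦ R_w(α1, α2) is strictly increasing on [0,1]. -/
theorem aux_mono (B c γ h1 h2 : ℝ) (hB : 0 < B) (hc : 0 < c) (hγ : 0 < γ)
    (hh1 : 0 < h1) (hh2 : 0 < h2) (a x y : ℝ) (ha1 : a ≤ 1)
    (hx0 : 0 ≤ x) (hy1 : y ≤ 1) (hxy : x < y) :
    B / 2 * Real.log (1 + c * (h1 * Real.sqrt x + h2 * Real.sqrt a) ^ 2 /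
        (c * h1 ^ 2 * (1 - x) + c * h2 ^ 2 * (1 - a) + 1 / γ)) <
    B / 2 * Real.log (1 + c * (h1 * Real.sqrt y + h2 * Real.sqrt a) ^ 2 /
        (c * h1 ^ 2 * (1 - y) + c * h2 ^ 2 * (1 - a) + 1 / γ)) := by
  have hs : Real.sqrt x < Real.sqrt y := Real.sqrt_lt_sqrt hx0 hxy
  have h1y : 0 ≤ 1 - y := by linarith
  have h1a : 0 ≤ 1 - a := by linarith
  have h1x : 0 ≤ 1 - x := by linarith
  have hD : 0 < c * h1 ^ 2 * (1 - y) + c * h2 ^ 2 * (1 - a) + 1 / γ := by positivity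
  have hDx : 0 < c * h1 ^ 2 * (1 - x) + c * h2 ^ 2 * (1 - a) + 1 / γ := by positivity
  have hle : c * h1 ^ 2 * (1 - y) + c * h2 ^ 2 * (1 - a) + 1 / γ ≤
      c * h1 ^ 2 * (1 - x) + c * h2 ^ 2 * (1 - a) + 1 / γ := by gcongr
  have hN : c * (h1 * Real.sqrt x + h2 * Real.sqrt a) ^ 2 <
      c * (h1 * Real.sqrt y + h2 * Real.sqrt a) ^ 2 := by gcongr
  have hq := div_lt_div₀ hN hle (by positivity) hD
  apply mul_lt_mul_of_pos_left _ (by positivity)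
  apply Real.log_lt_log (by positivity)
  linarith

/-- R_w is strictly increasing in each of its arguments on [0,1]. -/
theorem stmt_8 (B c γ h1 h2 : ℝ) (hB : 0 < B) (hc : 0 < c) (hγ : 0 < γ)
    (hh1 : 0 < h1) (hh2 : 0 < h2)
    (Rw : ℝ → ℝ → ℝ)
    (hRw : ∀ α1 α2, Rw α1 α2 = B / 2 * Real.log (1 +
      c * (h1 * Real.sqrt α1 + h2 * Real.sqrt α2) ^ 2 /
        (c * h1 ^ 2 * (1 - α1) + c * h2 ^ 2 * (1 - α2) + 1 / γ))) :
    (∀ α2 ∈ Set.Icc (0 : ℝ) 1, StrictMonoOn (fun α1 => Rw α1 α2) (Set.Icc (0 : ℝ) 1)) ∧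
    (∀ α1 ∈ Set.Icc (0 : ℝ) 1, StrictMonoOn (fun α2 => Rw α1 α2) (Set.Icc (0 : ℝ) 1)) := by
  constructor
  · intro a ha x hx y hy hxy
    simp only [hRw]
    exact aux_mono B c γ h1 h2 hB hc hγ hh1 hh2 a x y ha.2 hx.1 hy.2 hxy
  · intro a ha x hx y hy hxy
    simp only [hRw]
    have h := aux_mono B c γ h2 h1 hB hc hγ hh2 hh1 a x y ha.2 hx.1 hy.2 hxy
    rw [add_comm (h2 * Real.sqrt x), add_comm (h2 * Real.sqrt y),
      add_comm (c * h2 ^ 2 * (1 - x)), add_comm (c * h2 ^ 2 * (1 - y))] at h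
    exact h
end

section
/- (Equation (24).) For every α ∈ [0,1], one has R_d(α) ≥ R_s(α) if and only if α ≥ α0, where α0 = ((c·γ + 1) − √(c·γ + 1))/(c·γ). -/
/-- Equation (24): for every α ∈ [0,1], R_d(α) ≥ R_s(α) iff α ≥ α0,
    where α0 = ((c·γ + 1) − √(c·γ + 1))/(c·γ). -/
theorem stmt_10 (B c γ : ℝ) (hB : 0 < B) (hc : 0 < c) (hγ : 0 < γ)
    (Rs : ℝ → ℝ) (hRs : ∀ α, Rs α = B / 2 * Real.log (1 + c * γ * (1 - α)))
    (Rd : ℝ → ℝ) (hRd : ∀ α, Rd α = B / 2 * Real.log (1 + c * α / (c * (1 - α) + 1 / γ)))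
    (α0 : ℝ) (hα0 : α0 = ((c * γ + 1) - Real.sqrt (c * γ + 1)) / (c * γ)) :
    ∀ α ∈ Set.Icc (0 : ℝ) 1, Rd α ≥ Rs α ↔ α ≥ α0 := by
  rintro α ⟨h0, h1⟩
  have hk : 0 < c * γ := mul_pos hc hγ
  have h1' : 0 ≤ 1 - α := by linarith
  have hu : 0 < 1 + c * γ * (1 - α) := by positivity
  have hd : 0 < c * (1 - α) + 1 / γ := by positivity
  have key : 1 + c * α / (c * (1 - α) + 1 / γ) = (c * γ + 1) / (1 + c * γ * (1 - α)) := by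
    have e : c * (1 - α) + 1 / γ = (1 + c * γ * (1 - α)) / γ := by
      field_simp
      ring
    rw [e, div_div_eq_mul_div, eq_div_iff hu.ne', add_mul, div_mul_cancel₀ _ hu.ne']
    ring
  have hq : 0 < (c * γ + 1) / (1 + c * γ * (1 - α)) := by positivity
  rw [hRd, hRs, hα0, key, ge_iff_le, ge_iff_le, mul_le_mul_iff_right₀ (by positivity),
    Real.log_le_log_iff hu hq, le_div_iff₀ hu, div_le_iff₀ hk, ← sq,
    ← Real.le_sqrt' hu]
  constructor <;> intro h <;> linarith
end

section
/- For every α ∈ [0,1], min(R_d(α), R_s(α)) ≤ (B/4)·log(1 + c·γ), with equality if and only if α = α0, where α0 = ((c·γ + 1) − √(c·γ + 1))/(c·γ); in particular R_d(α0) = R_s(α0) = (B/4)·log(1 + c·γ). -/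
/-- min(R_d(α), R_s(α)) ≤ (B/4)·log(1 + c·γ) on [0,1] with equality iff α = α0;
    in particular R_d(α0) = R_s(α0) = (B/4)·log(1 + c·γ). -/
theorem stmt_11 (B c γ : ℝ) (hB : 0 < B) (hc : 0 < c) (hγ : 0 < γ)
    (Rs : ℝ → ℝ) (hRs : ∀ α, Rs α = B / 2 * Real.log (1 + c * γ * (1 - α)))
    (Rd : ℝ → ℝ) (hRd : ∀ α, Rd α = B / 2 * Real.log (1 + c * α / (c * (1 - α) + 1 / γ)))
    (α0 : ℝ) (hα0 : α0 = ((c * γ + 1) - Real.sqrt (c * γ + 1)) / (c * γ)) :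
    (∀ α ∈ Set.Icc (0 : ℝ) 1,
      min (Rd α) (Rs α) ≤ B / 4 * Real.log (1 + c * γ) ∧
      (min (Rd α) (Rs α) = B / 4 * Real.log (1 + c * γ) ↔ α = α0)) ∧
    Rd α0 = B / 4 * Real.log (1 + c * γ) ∧
    Rs α0 = B / 4 * Real.log (1 + c * γ) := by
  have hcg : 0 < c * γ := mul_pos hc hγ
  have hsum : ∀ α ≤ 1, Rd α + Rs α = B / 2 * Real.log (1 + c * γ) := by
    intro α h
    have h1 : 0 ≤ c * (1 - α) := mul_nonneg hc.le (by linarith)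
    have h2 : 0 < 1 + c * γ * (1 - α) := by
      have := mul_nonneg hcg.le (sub_nonneg.2 h)
      linarith
    have h3 : 1 + c * α / (c * (1 - α) + 1 / γ) = (1 + c * γ) / (1 + c * γ * (1 - α)) := by
      have h4 : c * (1 - α) + 1 / γ = (1 + c * γ * (1 - α)) / γ := by
        field_simp
        ring
      rw [h4, div_div_eq_mul_div, eq_div_iff h2.ne', add_mul, div_mul_cancel₀ _ h2.ne']
      ring
    rw [hRd, hRs, h3, Real.log_div (by linarith) h2.ne']
    ring
  have hs0 : 1 + c * γ * (1 - α0) = Real.sqrt (c * γ + 1) := by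
    rw [hα0]
    field_simp
    ring
  have hs1 : 1 ≤ Real.sqrt (c * γ + 1) := Real.one_le_sqrt.2 (by linarith)
  have hle : α0 ≤ 1 := by
    by_contra hh
    have := mul_pos hcg (sub_pos.2 (not_le.1 hh))
    linarith
  have hR0 : Rs α0 = B / 4 * Real.log (1 + c * γ) := by
    rw [hRs, hs0, Real.log_sqrt (by linarith), add_comm (c * γ)]
    ring
  have hD0 : Rd α0 = B / 4 * Real.log (1 + c * γ) := by
    have := hsum α0 hle
    linarith
  refine ⟨fun α hα => ?_, hD0, hR0⟩
  have hS := hsum α hα.2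
  refine ⟨?_, ?_, ?_⟩
  · rcases le_total (Rd α) (Rs α) with h | h
    · rw [min_eq_left h]; linarith
    · rw [min_eq_right h]; linarith
  · intro he
    have hE : Rs α = Rs α0 := by
      rcases le_total (Rd α) (Rs α) with h | h
      · rw [min_eq_left h] at he; linarith
      · rw [min_eq_right h] at he; linarith
    rw [hRs, hRs] at hE
    have hl := mul_left_cancel₀ (by positivity) hE
    have h2 : 0 < 1 + c * γ * (1 - α) := by
      have := mul_nonneg hcg.le (sub_nonneg.2 hα.2)
      linarith
    have h3 := Real.log_injOn_pos (Set.mem_Ioi.2 h2) (Set.mem_Ioi.2 (by linarith)) hl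
    have h4 := mul_left_cancel₀ hcg.ne' (add_left_cancel h3)
    linarith
  · rintro rfl
    rw [hD0, hR0, min_self]
end

section
/- (Optimal solution of Problem P4.) The maximum over (α1, α2) ∈ [0,1]² of min{R_d(α1), R_s(α1), R_d(α2), R_s(α2)} equals (B/4)·log(1 + c·γ), and it is attained exactly at the point (α1, α2) = (α0, α0), where α0 = ((c·γ + 1) − √(c·γ + 1))/(c·γ). -/
/-- Optimal solution of problem P4: the maximum over [0,1]² of
    min{R_d(α1), R_s(α1), R_d(α2), R_s(α2)} equals (B/4)·log(1 + c·γ)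
    and is attained exactly at (α0, α0). -/
theorem stmt_12 (B c γ : ℝ) (hB : 0 < B) (hc : 0 < c) (hγ : 0 < γ)
    (Rs : ℝ → ℝ) (hRs : ∀ α, Rs α = B / 2 * Real.log (1 + c * γ * (1 - α)))
    (Rd : ℝ → ℝ) (hRd : ∀ α, Rd α = B / 2 * Real.log (1 + c * α / (c * (1 - α) + 1 / γ)))
    (α0 : ℝ) (hα0 : α0 = ((c * γ + 1) - Real.sqrt (c * γ + 1)) / (c * γ)) :
    α0 ∈ Set.Icc (0 : ℝ) 1 ∧
    min (Rd α0) (min (Rs α0) (min (Rd α0) (Rs α0))) = B / 4 * Real.log (1 + c * γ) ∧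
    (∀ α1 ∈ Set.Icc (0 : ℝ) 1, ∀ α2 ∈ Set.Icc (0 : ℝ) 1,
      min (Rd α1) (min (Rs α1) (min (Rd α2) (Rs α2))) ≤ B / 4 * Real.log (1 + c * γ) ∧
      (min (Rd α1) (min (Rs α1) (min (Rd α2) (Rs α2))) = B / 4 * Real.log (1 + c * γ) ↔
        α1 = α0 ∧ α2 = α0)) := by
  have hk : 0 < c * γ := mul_pos hc hγ
  have hsq : Real.sqrt (c * γ + 1) ^ 2 = c * γ + 1 := Real.sq_sqrt (by linarith)
  have hs1 : 1 ≤ Real.sqrt (c * γ + 1) := Real.one_le_sqrt.mpr (by linarith)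
  have hmul : c * γ * α0 = (c * γ + 1) - Real.sqrt (c * γ + 1) := by
    rw [hα0]; field_simp
  have hmem : α0 ∈ Set.Icc (0 : ℝ) 1 := by
    constructor
    · by_contra! h
      nlinarith [mul_pos hk (neg_pos.mpr h)]
    · by_contra! h
      nlinarith [mul_pos hk (sub_pos.mpr h)]
  have hpos : ∀ α ∈ Set.Icc (0 : ℝ) 1, 0 < 1 + c * γ * (1 - α) := by
    intro α hα
    have := mul_nonneg hk.le (sub_nonneg.mpr hα.2)
    linarith
  have hsum : ∀ α ∈ Set.Icc (0 : ℝ) 1, Rd α + Rs α = B / 2 * Real.log (1 + c * γ) := by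
    intro α hα
    have hp := hpos α hα
    have hd : 0 < c * (1 - α) + 1 / γ := by
      have := mul_nonneg hc.le (sub_nonneg.mpr hα.2)
      positivity
    have e : 1 + c * α / (c * (1 - α) + 1 / γ) = (1 + c * γ) / (1 + c * γ * (1 - α)) := by
      have e2 : c * (1 - α) + 1 / γ = (1 + c * γ * (1 - α)) / γ := by
        field_simp
        ring
      rw [e2, div_div_eq_mul_div, eq_div_iff hp.ne', add_mul, div_mul_cancel₀ _ hp.ne']
      ring
    rw [hRd, hRs, e, Real.log_div (by linarith) hp.ne']
    ring
  have hs0 : Rs α0 = B / 4 * Real.log (1 + c * γ) := by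
    have e : 1 + c * γ * (1 - α0) = Real.sqrt (c * γ + 1) := by linarith
    rw [hRs, e, Real.log_sqrt (by linarith), add_comm (c * γ) 1]
    ring
  have hd0 : Rd α0 = B / 4 * Real.log (1 + c * γ) := by
    have := hsum α0 hmem
    linarith
  have hinj : ∀ α ∈ Set.Icc (0 : ℝ) 1, B / 4 * Real.log (1 + c * γ) ≤ Rd α →
      B / 4 * Real.log (1 + c * γ) ≤ Rs α → α = α0 := by
    intro α hα h1 h2
    have h3 := hsum α hα
    have h4 : Rs α = Rs α0 := by linarith
    rw [hRs, hRs] at h4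
    have h5 := mul_left_cancel₀ (by positivity) h4
    have h6 := Real.log_injOn_pos (hpos α hα) (hpos α0 hmem) h5
    have h7 := mul_left_cancel₀ hk.ne' (add_left_cancel h6)
    linarith
  refine ⟨hmem, by simp [hs0, hd0], ?_⟩
  intro α1 h1 α2 h2
  refine ⟨?_, ?_, ?_⟩
  · have h3 := hsum α1 h1
    by_contra! h
    simp only [lt_min_iff] at h
    linarith [h.1, h.2.1]
  · intro h
    have h' := h.ge
    simp only [le_min_iff] at h'
    exact ⟨hinj α1 h1 h'.1 h'.2.1, hinj α2 h2 h'.2.2.1 h'.2.2.2⟩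
  · rintro ⟨rfl, rfl⟩
    simp [hs0, hd0]
end

section
/- (Optimal solution of Problem P2.) Assume α_min ≤ α_max and α_min, α_max ∈ [0,1]. Then for every real constant C, the function (α1, α2) ↦ R_s(α1) + R_s(α2) + min{R_d(α1), C, R_d(α2)} attains its maximum over the square [α_min, α_max]² at the point (α1, α2) = (α_min, α_min). -/
/-- Optimal solution of problem P2: for every constant C, the function
    (α1, α2) ↦ R_s(α1) + R_s(α2) + min{R_d(α1), C, R_d(α2)} attains its maximum
    over [α_min, α_max]² at (α_min, α_min). -/
theorem stmt_13 (B c γ Rth : ℝ) (hB : 0 < B) (hc : 0 < c) (hγ : 0 < γ) (hR : 0 ≤ Rth)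
    (Rs : ℝ → ℝ) (hRs : ∀ α, Rs α = B / 2 * Real.log (1 + c * γ * (1 - α)))
    (Rd : ℝ → ℝ) (hRd : ∀ α, Rd α = B / 2 * Real.log (1 + c * α / (c * (1 - α) + 1 / γ)))
    (t : ℝ) (ht : t = Real.exp (2 * Rth / B) - 1)
    (αmin : ℝ) (hαmin : αmin = t * (c * γ + 1) / (c * γ * (1 + t)))
    (αmax : ℝ) (hαmax : αmax = 1 - t / (c * γ))
    (hle : αmin ≤ αmax) (hmin01 : αmin ∈ Set.Icc (0 : ℝ) 1)
    (hmax01 : αmax ∈ Set.Icc (0 : ℝ) 1) :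
    ∀ C : ℝ, ∀ α1 ∈ Set.Icc αmin αmax, ∀ α2 ∈ Set.Icc αmin αmax,
      Rs α1 + Rs α2 + min (Rd α1) (min C (Rd α2)) ≤
        Rs αmin + Rs αmin + min (Rd αmin) (min C (Rd αmin)) := by
  have hcg : 0 < c * γ := mul_pos hc hγ
  have hpos : ∀ α, α ≤ 1 → 0 < 1 + c * γ * (1 - α) := fun α h => by
    have := mul_nonneg hcg.le (sub_nonneg.2 h)
    linarith
  have key : ∀ α, α ≤ 1 → Rs α + Rd α = B / 2 * Real.log (1 + c * γ) := by
    intro α h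
    have h1 := hpos α h
    have h2 : 1 + c * α / (c * (1 - α) + 1 / γ) = (1 + c * γ) / (1 + c * γ * (1 - α)) := by
      have h3 : c * (1 - α) + 1 / γ = (1 + c * γ * (1 - α)) / γ := by
        field_simp
        ring
      rw [h3, div_div_eq_mul_div, eq_div_iff h1.ne', add_mul, div_mul_cancel₀ _ h1.ne']
      ring
    rw [hRs, hRd, h2, Real.log_div (by positivity) h1.ne']
    ring
  have anti : ∀ α, αmin ≤ α → α ≤ 1 → Rs α ≤ Rs αmin := by
    intro α h h'
    rw [hRs, hRs]
    apply mul_le_mul_of_nonneg_left _ (by positivity)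
    apply Real.log_le_log (hpos α h')
    have := mul_le_mul_of_nonneg_left h hcg.le
    linarith
  intro C α1 h1 α2 h2
  have b1 := h1.2.trans hmax01.2
  have b2 := h2.2.trans hmax01.2
  have a1 := anti α1 h1.1 b1
  have a2 := anti α2 h2.1 b2
  have k1 := key α1 b1
  have k0 := key αmin hmin01.2
  have m1 := min_le_left (Rd α1) (min C (Rd α2))
  have m2 := (min_le_right (Rd α1) (min C (Rd α2))).trans (min_le_left _ _)
  have m3 : min (Rd α1) (min C (Rd α2)) - (Rs αmin + Rs αmin - Rs α1 - Rs α2) ≤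
      min (Rd αmin) (min C (Rd αmin)) := by
    refine le_min ?_ (le_min ?_ ?_) <;> linarith
  linarith
end

section
/- (Reduction of the min in Problem P3.) For all (α1, α2) ∈ [α0, 1]², one has min{R_d(α1), R_s(α1), R_d(α2), R_s(α2), R_w(α1,α2)} = min{R_s(α1), R_s(α2), R_w(α1,α2)}, where α0 = ((c·γ + 1) − √(c·γ + 1))/(c·γ). -/
/-- Reduction of the min in problem P3: on [α0, 1]², the min of the five rates
    equals the min of R_s(α1), R_s(α2) and R_w(α1,α2). -/
theorem stmt_14 (B c γ h1 h2 : ℝ) (hB : 0 < B) (hc : 0 < c) (hγ : 0 < γ)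
    (hh1 : 0 < h1) (hh2 : 0 < h2)
    (Rs : ℝ → ℝ) (hRs : ∀ α, Rs α = B / 2 * Real.log (1 + c * γ * (1 - α)))
    (Rd : ℝ → ℝ) (hRd : ∀ α, Rd α = B / 2 * Real.log (1 + c * α / (c * (1 - α) + 1 / γ)))
    (Rw : ℝ → ℝ → ℝ)
    (hRw : ∀ α1 α2, Rw α1 α2 = B / 2 * Real.log (1 +
      c * (h1 * Real.sqrt α1 + h2 * Real.sqrt α2) ^ 2 /
        (c * h1 ^ 2 * (1 - α1) + c * h2 ^ 2 * (1 - α2) + 1 / γ)))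
    (α0 : ℝ) (hα0 : α0 = ((c * γ + 1) - Real.sqrt (c * γ + 1)) / (c * γ)) :
    ∀ α1 ∈ Set.Icc α0 1, ∀ α2 ∈ Set.Icc α0 1,
      min (Rd α1) (min (Rs α1) (min (Rd α2) (min (Rs α2) (Rw α1 α2)))) =
        min (Rs α1) (min (Rs α2) (Rw α1 α2)) := by
  have key : ∀ α ∈ Set.Icc α0 1, Rs α ≤ Rd α := by
    rintro α ⟨ha, hb⟩
    have hcg : 0 < c * γ := mul_pos hc hγ
    rw [hα0, div_le_iff₀ hcg] at ha
    have hx : 1 ≤ 1 + c * γ * (1 - α) := by nlinarith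
    have hxs : 1 + c * γ * (1 - α) ≤ Real.sqrt (c * γ + 1) := by nlinarith
    have hsq : (1 + c * γ * (1 - α)) ^ 2 ≤ c * γ + 1 := by
      have h := Real.sq_sqrt (show 0 ≤ c * γ + 1 by linarith)
      nlinarith
    have hpos : 0 < 1 + c * γ * (1 - α) := by linarith
    have hden : c * (1 - α) + 1 / γ = (1 + c * γ * (1 - α)) / γ := by
      field_simp
      ring
    have heq : 1 + c * α / (c * (1 - α) + 1 / γ) = (c * γ + 1) / (1 + c * γ * (1 - α)) := by
      rw [hden, div_div_eq_mul_div, eq_div_iff hpos.ne', add_mul, div_mul_cancel₀ _ hpos.ne']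
      ring
    rw [hRs, hRd, heq]
    apply mul_le_mul_of_nonneg_left _ (by linarith)
    apply Real.log_le_log hpos
    rw [le_div_iff₀ hpos]
    nlinarith
  intro α1 h1' α2 h2'
  rw [← min_assoc (Rd α1), min_eq_right (key α1 h1'), ← min_assoc (Rd α2),
    min_eq_right (key α2 h2')]
end
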